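/- Let C = ⟨(x^n − λ₀)^ν⟩ be an ideal of R[x]/⟨x^{np^s} − λ⟩, where 0 ≤ ν ≤ e·p^s, and for 0 ≤ ρ ≤ np^s let A_ρ denote the number of codewords of C with RT weight equal to ρ. Then A_0 = 1 in all cases, and for 1 ≤ ρ ≤ np^s: (a) if ν = ep^s, then A_ρ = 0; (b) if (e−1)p^s + 1 ≤ ν ≤ ep^s − 1, then A_ρ = 0 for 1 ≤ ρ ≤ nν − n(e−1)p^s and A_ρ = (p^m − 1)p^{m(ρ − nν + n(e−1)p^s − 1)} for nν − n(e−1)p^s + 1 ≤ ρ ≤ np^s; (c) if ν = y·p^s with 0 ≤ y ≤ e − 1, then A_ρ = (p^{m(e−y)} − 1)p^{m(e−y)(ρ−1)}; (d) if (b−1)p^s + 1 ≤ ν ≤ b·p^s − 1 for some 1 ≤ b ≤ e − 1, then A_ρ = (p^{m(e−b)} − 1)p^{m(e−b)(ρ−1)} for 1 ≤ ρ ≤ nν − n(b−1)p^s, and A_ρ = (p^{m(e−b+1)} − 1)·p^{m((e−b+1)ρ − nν + n(b−1)p^s − 1 − (e−b))} for nν − n(b−1)p^s + 1 ≤ ρ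 ≤ np^s. -/

import Mathlib

open Polynomial

/-- The unique representative of degree `< deg q` of an element of `A[x]/⟨q⟩`
(for `q` monic). -/
noncomputable def polyRep {A : Type} [CommRing A] (q : A[X]) (c : A[X] ⧸ Ideal.span {q}) :
    A[X] :=
  Function.surjInv Ideal.Quotient.mk_surjective c %ₘ q

open Classical in
/-- RT (Rosenbloom–Tsfasman) weight of a codeword: `1 + deg` of its representative,
and `0` for the zero codeword. -/
noncomputable def wRT {A : Type} [CommRing A] (q : A[X]) (c : A[X] ⧸ Ideal.span {q}) : ℕ :=
  if c = 0 then 0 else (polyRep q c).natDegree + 1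

/-- The number of codewords of the code `I ⊆ A[x]/⟨q⟩` with RT weight `ρ`. -/
noncomputable def rtCount {A : Type} [CommRing A] (q : A[X])
    (I : Ideal (A[X] ⧸ Ideal.span {q})) (ρ : ℕ) : ℕ :=
  Set.ncard {c : A[X] ⧸ Ideal.span {q} | c ∈ I ∧ wRT q c = ρ}

lemma card_fib {M H : Type*} [AddCommGroup M] [AddCommGroup H] (φ : M →+ H)
    (D D' : AddSubgroup M) (E : AddSubgroup H) (hle : D' ≤ D)
    (hk : ∀ x ∈ D, φ x = 0 ↔ x ∈ D') (hE : ∀ y, y ∈ E ↔ ∃ x ∈ D, φ x = y) :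
    Nat.card D = Nat.card D' * Nat.card E := by
  have h1 := AddSubgroup.card_mul_index ((φ.comp D.subtype).ker)
  rw [AddSubgroup.index_ker] at h1
  have h2 : (φ.comp D.subtype).range = E := by
    ext y
    rw [hE]
    constructor
    · rintro ⟨x, rfl⟩; exact ⟨x, x.2, rfl⟩
    · rintro ⟨x, hx, rfl⟩; exact ⟨⟨x, hx⟩, rfl⟩
  have h3 : (φ.comp D.subtype).ker = D'.addSubgroupOf D := by
    ext x
    rw [AddMonoidHom.mem_ker, AddSubgroup.mem_addSubgroupOf]
    exact hk x x.2
  rw [h2, h3, Nat.card_congr (AddSubgroup.addSubgroupOfEquivOfLe hle).toEquiv] at h1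
  exact h1.symm

lemma card_gamma {R : Type} [CommRing R] [Finite R] (e Q : ℕ) (γ : R)
    (hγ : γ ^ (e - 1) ≠ 0) (hγe : γ ^ e = 0)
    (hmax : ∀ a : R, a ∈ Ideal.span {γ} ↔ ¬ IsUnit a)
    (hres : Nat.card (R ⧸ Ideal.span {γ}) = Q) (j : ℕ) :
    Nat.card (Ideal.span {γ ^ j} : Ideal R) = Q ^ (e - j) := by
  have hzero : ∀ j, e ≤ j → Nat.card (Ideal.span {γ ^ j} : Ideal R) = 1 := by
    intro j hj
    have : γ ^ j = 0 := pow_eq_zero_of_le hj hγe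
    rw [this, Ideal.span_singleton_zero]
    exact Nat.card_unique
  have hstep : ∀ j, j < e → Nat.card (Ideal.span {γ ^ j} : Ideal R) =
      Nat.card (Ideal.span {γ ^ (j + 1)} : Ideal R) * Q := by
    intro j hj
    let mk := (Ideal.Quotient.mk (Ideal.span {γ ^ (j + 1)})).toAddMonoidHom
    let mu := AddMonoidHom.mulLeft (γ ^ j)
    have hA := card_fib mk (Ideal.span {γ ^ j} : Ideal R).toAddSubgroup
      (Ideal.span {γ ^ (j + 1)} : Ideal R).toAddSubgroup
      ((Ideal.span {γ ^ j} : Ideal R).toAddSubgroup.map mk)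
      (by
        change (Ideal.span {γ ^ (j + 1)} : Ideal R) ≤ Ideal.span {γ ^ j}
        rw [Ideal.span_singleton_le_span_singleton]
        exact pow_dvd_pow _ (Nat.le_succ j))
      (by
        intro x hx
        exact Ideal.Quotient.eq_zero_iff_mem)
      (by intro y; rfl)
    have hB := card_fib (mk.comp mu) ⊤
      (Ideal.span {γ} : Ideal R).toAddSubgroup
      ((Ideal.span {γ ^ j} : Ideal R).toAddSubgroup.map mk)
      le_top
      (by
        intro x _
        change Ideal.Quotient.mk (Ideal.span {γ ^ (j + 1)}) (γ ^ j * x) = 0 ↔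
          x ∈ (Ideal.span {γ} : Ideal R)
        rw [Ideal.Quotient.eq_zero_iff_mem, Ideal.mem_span_singleton]
        constructor
        · rintro ⟨r, hr⟩
          rw [hmax]
          intro hx
          have h1 : IsUnit (x - γ * r) := by
            have hn0 : IsNilpotent (γ * r) := ⟨e, by rw [mul_pow, hγe, zero_mul]⟩
            have hn : IsNilpotent (-(γ * r)) := hn0.neg
            rw [sub_eq_add_neg]
            exact hn.isUnit_add_left_of_commute hx (Commute.all _ _)
          have h2 : γ ^ j * (x - γ * r) = 0 := by
            rw [mul_sub, hr]; ring
          rw [h1.mul_left_eq_zero] at h2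
          exact hγ (pow_eq_zero_of_le (by omega) h2)
        · intro hx
          rw [Ideal.mem_span_singleton] at hx
          rw [pow_succ]
          exact mul_dvd_mul_left _ hx)
      (by
        intro y
        rw [AddSubgroup.mem_map]
        constructor
        · rintro ⟨x, hx, rfl⟩
          obtain ⟨r, rfl⟩ := Ideal.mem_span_singleton.1 hx
          exact ⟨r, trivial, rfl⟩
        · rintro ⟨x, hx, rfl⟩
          exact ⟨γ ^ j * x, Ideal.mem_span_singleton.2 (dvd_mul_right _ _), rfl⟩)
    have hC := AddSubgroup.card_mul_index (Ideal.span {γ} : Ideal R).toAddSubgroup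
    have hD : (Ideal.span {γ} : Ideal R).toAddSubgroup.index = Q := hres
    rw [hD] at hC
    have hT : Nat.card (⊤ : AddSubgroup R) = Nat.card R := AddSubgroup.card_top
    rw [hT, ← hC] at hB
    have hpos : 0 < Nat.card (Ideal.span {γ} : Ideal R).toAddSubgroup := Nat.card_pos
    have hE := Nat.eq_of_mul_eq_mul_left hpos hB
    rw [← hE] at hA
    exact hA
  by_cases hj : e ≤ j
  · rw [hzero j hj, Nat.sub_eq_zero_of_le hj, pow_zero]
  · obtain ⟨k, hk⟩ : ∃ k, k = e - j := ⟨_, rfl⟩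
    induction k generalizing j with
    | zero => omega
    | succ k ih =>
      rw [hstep j (by omega), ← hk, pow_succ Q]
      congr 1
      by_cases hj' : e ≤ j + 1
      · rw [hzero _ hj']
        have : k = 0 := by omega
        rw [this, pow_zero]
      · rw [ih (j + 1) hj' (by omega)]
        congr 1; omega

lemma mem_form {R : Type} [CommRing R] [Nontrivial R] (q f v : R[X]) (γ : R) (P a t : ℕ)
    (hq : q.Monic) (hf : f ^ P = q + C γ * v) (ht : t ≤ P) (g : R[X])
    (hg : g.degree < q.degree)
    (hmem : Ideal.Quotient.mk (Ideal.span {q}) g ∈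
      Ideal.span {Ideal.Quotient.mk (Ideal.span {q}) (f ^ (a * P + t))}) :
    ∃ h1 h2, g = C γ ^ a * (f ^ t * h1 + C γ * h2) := by
  obtain ⟨c, hc⟩ := Ideal.mem_span_singleton.1 hmem
  obtain ⟨c, rfl⟩ := Ideal.Quotient.mk_surjective c
  rw [← map_mul, Ideal.Quotient.eq, Ideal.mem_span_singleton] at hc
  -- f^(aP+t) c ≡ γ^a v^a f^t c
  have h1 : q ∣ f ^ (a * P + t) * c - C γ ^ a * (v ^ a * f ^ t * c) := by
    have h : q ∣ (f ^ P) ^ a - (C γ * v) ^ a := by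
      refine dvd_trans ?_ (sub_dvd_pow_sub_pow _ _ _)
      rw [hf]; simp
    have : f ^ (a * P + t) * c - C γ ^ a * (v ^ a * f ^ t * c) =
      ((f ^ P) ^ a - (C γ * v) ^ a) * (f ^ t * c) := by
      rw [mul_comm a P, pow_add, pow_mul]; ring
    rw [this]
    exact dvd_mul_of_dvd_left h _
  have h2 : q ∣ g - C γ ^ a * (v ^ a * f ^ t * c) := by
    have := dvd_add hc h1
    simpa using this
  set r := v ^ a * f ^ t * c with hr
  have h3 := modByMonic_add_div r q
  have h4 : q ∣ g - C γ ^ a * (r %ₘ q) := by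
    have : g - C γ ^ a * (r %ₘ q) = (g - C γ ^ a * r) + q * (C γ ^ a * (r /ₘ q)) := by
      linear_combination -(C γ ^ a) * h3
    rw [this]
    exact dvd_add h2 (dvd_mul_right _ _)
  have h5 : (g - C γ ^ a * (r %ₘ q)).degree < q.degree := by
    refine lt_of_le_of_lt (degree_sub_le _ _) (max_lt hg ?_)
    rw [← C_pow, ← smul_eq_C_mul]
    exact lt_of_le_of_lt (degree_smul_le _ _) (degree_modByMonic_lt _ hq)
  have h6 : g - C γ ^ a * (r %ₘ q) = 0 := by
    by_contra h
    exact hq.not_dvd_of_degree_lt h h5 h4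
  refine ⟨v ^ a * c - f ^ (P - t) * (r /ₘ q), v * (r /ₘ q), ?_⟩
  have h7 : f ^ P = f ^ t * f ^ (P - t) := by rw [← pow_add]; congr 1; omega
  rw [sub_eq_zero.1 h6]
  congr 1
  have h8 : q = f ^ t * f ^ (P - t) - C γ * v := by rw [← h7, hf]; ring
  have h9 : r %ₘ q = r - q * (r /ₘ q) := by linear_combination h3
  generalize r /ₘ q = d at *
  rw [h9, hr, h8]; ring

lemma mem_gen {R : Type} [CommRing R] (q f v : R[X]) (γ : R) (P a t : ℕ)
    (hf : f ^ P = q + C γ * v) (ht : t ≤ P)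
    (hv : IsUnit (Ideal.Quotient.mk (Ideal.span {q}) v)) :
    Ideal.Quotient.mk (Ideal.span {q}) (C γ ^ a * f ^ t) ∈
      Ideal.span {Ideal.Quotient.mk (Ideal.span {q}) (f ^ (a * P + t))} ∧
    Ideal.Quotient.mk (Ideal.span {q}) (C γ ^ (a + 1)) ∈
      Ideal.span {Ideal.Quotient.mk (Ideal.span {q}) (f ^ (a * P + t))} := by
  have hq0 : Ideal.Quotient.mk (Ideal.span {q}) q = 0 :=
    Ideal.Quotient.eq_zero_iff_mem.2 (Ideal.mem_span_singleton_self q)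
  have hF := congrArg (Ideal.Quotient.mk (Ideal.span {q})) hf
  simp only [map_pow, map_add, map_mul, hq0, zero_add] at hF ⊢
  set F := Ideal.Quotient.mk (Ideal.span {q}) f
  set G := Ideal.Quotient.mk (Ideal.span {q}) (C γ)
  obtain ⟨u, hu⟩ := hv.exists_right_inv
  set V := Ideal.Quotient.mk (Ideal.span {q}) v
  have key : F ^ (a * P + t) = G ^ a * V ^ a * F ^ t := by
    rw [pow_add, mul_comm a P, pow_mul, hF, mul_pow]
  have k2 : F ^ t * F ^ (P - t) = G * V := by rw [← pow_add, ← hF]; congr 1; omega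
  have h1 : F ^ (a * P + t) ∣ G ^ a * F ^ t := by
    refine ⟨u ^ a, ?_⟩
    have : V ^ a * u ^ a = 1 := by rw [← mul_pow, hu, one_pow]
    rw [key]
    linear_combination -(G ^ a * F ^ t) * this
  refine ⟨Ideal.mem_span_singleton.2 h1, Ideal.mem_span_singleton.2 ?_⟩
  refine h1.trans ⟨F ^ (P - t) * u, ?_⟩
  linear_combination -(G ^ a * u) * k2 - G ^ (a + 1) * hu

/-- codeword representatives of degree less than `ρ` -/
noncomputable def Dlt {R : Type} [CommRing R] (q : R[X]) (I : Ideal (R[X] ⧸ Ideal.span {q}))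
    (ρ : ℕ) : AddSubgroup R[X] :=
  (degreeLT R ρ).toAddSubgroup ⊓ (I.comap (Ideal.Quotient.mk (Ideal.span {q}))).toAddSubgroup

lemma mem_Dlt {R : Type} [CommRing R] (q : R[X]) (I : Ideal (R[X] ⧸ Ideal.span {q}))
    (ρ : ℕ) (g : R[X]) :
    g ∈ Dlt q I ρ ↔ g.degree < ρ ∧ Ideal.Quotient.mk (Ideal.span {q}) g ∈ I := by
  unfold Dlt
  rw [AddSubgroup.mem_inf, Submodule.mem_toAddSubgroup, mem_degreeLT]
  rfl

lemma Dlt_finite {R : Type} [CommRing R] [Finite R] (q : R[X])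
    (I : Ideal (R[X] ⧸ Ideal.span {q})) (ρ : ℕ) : (Dlt q I ρ : Set R[X]).Finite := by
  have : Finite (degreeLT R ρ) := Finite.of_equiv _ (degreeLTEquiv R ρ).symm.toEquiv
  have h : ((degreeLT R ρ : Submodule R R[X]) : Set R[X]).Finite := Set.toFinite _
  exact h.subset (fun x hx => hx.1)

lemma polyRep_mk {R : Type} [CommRing R] [Nontrivial R] (q : R[X]) (hq : q.Monic) (g : R[X])
    (hg : g.degree < q.degree) : polyRep q (Ideal.Quotient.mk (Ideal.span {q}) g) = g := by
  unfold polyRep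
  have h := Function.surjInv_eq (Ideal.Quotient.mk_surjective (I := Ideal.span {q}))
    (Ideal.Quotient.mk (Ideal.span {q}) g)
  rw [Ideal.Quotient.eq, Ideal.mem_span_singleton] at h
  refine Eq.trans ?_ ((modByMonic_eq_self_iff hq).2 hg)
  rw [← sub_eq_zero, ← sub_modByMonic]
  exact (modByMonic_eq_zero_iff_dvd hq).2 h

lemma mk_inj {R : Type} [CommRing R] [Nontrivial R] (q : R[X]) (hq : q.Monic) (g : R[X])
    (hg : g.degree < q.degree) (h : Ideal.Quotient.mk (Ideal.span {q}) g = 0) : g = 0 := by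
  by_contra h0
  rw [Ideal.Quotient.eq_zero_iff_mem, Ideal.mem_span_singleton] at h
  exact hq.not_dvd_of_degree_lt h0 hg h

lemma rtCount_zero {R : Type} [CommRing R] (q : R[X])
    (I : Ideal (R[X] ⧸ Ideal.span {q})) : rtCount q I 0 = 1 := by
  unfold rtCount
  rw [Set.ncard_eq_one]
  refine ⟨0, ?_⟩
  ext c
  simp only [Set.mem_ofPred_eq, Set.mem_singleton_iff, wRT]
  constructor
  · rintro ⟨_, h⟩
    by_contra hc
    rw [if_neg hc] at h
    omega
  · rintro rfl
    simp

lemma rtCount_succ {R : Type} [CommRing R] [Finite R] [Nontrivial R] (q : R[X]) (hq : q.Monic)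
    (I : Ideal (R[X] ⧸ Ideal.span {q})) (N : ℕ) (hN : q.degree = N) (ρ : ℕ) (hρ : ρ < N) :
    rtCount q I (ρ + 1) = Nat.card (Dlt q I (ρ + 1)) - Nat.card (Dlt q I ρ) := by
  have hset : {c : R[X] ⧸ Ideal.span {q} | c ∈ I ∧ wRT q c = ρ + 1} =
      Set.image (Ideal.Quotient.mk (Ideal.span {q}))
        ((Dlt q I (ρ + 1) : Set R[X]) \ (Dlt q I ρ : Set R[X])) := by
    ext c
    simp only [Set.mem_ofPred_eq, Set.mem_image, Set.mem_sdiff, SetLike.mem_coe, mem_Dlt, wRT]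
    constructor
    · rintro ⟨hc, hw⟩
      have hc0 : c ≠ 0 := by
        intro h; rw [if_pos h] at hw; omega
      rw [if_neg hc0] at hw
      obtain ⟨g, rfl⟩ := Ideal.Quotient.mk_surjective c
      have hgm : Ideal.Quotient.mk (Ideal.span {q}) (g %ₘ q) =
          Ideal.Quotient.mk (Ideal.span {q}) g := by
        rw [Ideal.Quotient.eq, Ideal.mem_span_singleton]
        refine ⟨-(g /ₘ q), ?_⟩
        linear_combination modByMonic_add_div g q
      rw [← hgm] at hc hw hc0 ⊢
      have hd := degree_modByMonic_lt g hq
      generalize g %ₘ q = g' at *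
      rw [polyRep_mk q hq g' hd] at hw
      have hg0 : g' ≠ 0 := by rintro rfl; simp at hc0
      refine ⟨g', ⟨⟨?_, hc⟩, ?_⟩, rfl⟩
      · rw [degree_eq_natDegree hg0, Nat.cast_lt]; omega
      · rintro ⟨h, _⟩
        rw [degree_eq_natDegree hg0, Nat.cast_lt] at h; omega
    · rintro ⟨g, ⟨⟨h1, h2⟩, h3⟩, rfl⟩
      have hg0 : g ≠ 0 := by
        rintro rfl
        exact h3 ⟨by simp, h2⟩
      have hd : g.degree < q.degree := by
        rw [hN]; exact lt_of_lt_of_le h1 (by exact_mod_cast hρ)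
      have h0 : Ideal.Quotient.mk (Ideal.span {q}) g ≠ 0 := fun h => hg0 (mk_inj q hq g hd h)
      refine ⟨h2, ?_⟩
      rw [if_neg h0, polyRep_mk q hq g hd]
      rw [degree_eq_natDegree hg0, Nat.cast_lt] at h1
      have : ¬ g.natDegree < ρ := by
        intro h
        exact h3 ⟨by rw [degree_eq_natDegree hg0, Nat.cast_lt]; exact h, h2⟩
      omega
  unfold rtCount
  rw [hset, Set.InjOn.ncard_image, Set.ncard_sdiff _ (Dlt_finite q I ρ)]
  · rfl
  · intro g hg
    have hg' := (mem_Dlt q I ρ g).1 hg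
    refine (mem_Dlt q I (ρ + 1) g).2 ⟨lt_trans hg'.1 ?_, hg'.2⟩
    exact_mod_cast Nat.lt_succ_self ρ
  · intro g hg g' hg' h
    have h1 := ((mem_Dlt q I _ g).1 hg.1).1
    have h2 := ((mem_Dlt q I _ g').1 hg'.1).1
    rw [← sub_eq_zero, ← map_sub] at h
    refine sub_eq_zero.1 (mk_inj q hq _ ?_ h)
    rw [hN]
    exact lt_of_lt_of_le (lt_of_le_of_lt (degree_sub_le _ _) (max_lt h1 h2)) (by exact_mod_cast hρ)

lemma nil_add_unit {A : Type*} [CommRing A] {x y : A} (hx : IsNilpotent x) (hy : IsUnit y) :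
    IsUnit (x + y) := hx.isUnit_add_right_of_commute hy (Commute.all _ _)

lemma Dlt_step {R : Type} [CommRing R] [Finite R] [Nontrivial R] (q f v : R[X]) (γ : R)
    (P a t n N : ℕ)
    (hq : q.Monic) (hN : q.degree = N) (hfm : f.Monic) (hfn : f.natDegree = n)
    (hf : f ^ P = q + C γ * v) (ht : t ≤ P)
    (hv : IsUnit (Ideal.Quotient.mk (Ideal.span {q}) v)) (ρ : ℕ) (hρ : ρ < N) :
    Nat.card (Dlt q (Ideal.span {Ideal.Quotient.mk (Ideal.span {q}) (f ^ (a * P + t))}) (ρ + 1)) =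
    Nat.card (Dlt q (Ideal.span {Ideal.Quotient.mk (Ideal.span {q}) (f ^ (a * P + t))}) ρ) *
      Nat.card (Ideal.span {γ ^ (if ρ < n * t then a + 1 else a)} : Ideal R) := by
  obtain ⟨hg1, hg2⟩ := mem_gen q f v γ P a t hf ht hv
  have hform := mem_form q f v γ P a t hq hf ht
  generalize Ideal.span {Ideal.Quotient.mk (Ideal.span {q}) (f ^ (a * P + t))} = I at *
  have hdeg : ∀ g : R[X], g.degree < (ρ + 1 : ℕ) → (g.degree < (ρ : ℕ) ↔ g.coeff ρ = 0) := by
    intro g hg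
    constructor
    · exact fun h => coeff_eq_zero_of_degree_lt h
    · intro h
      rw [degree_lt_iff_coeff_zero] at hg ⊢
      intro m hm
      rcases Nat.eq_or_lt_of_le hm with rfl | h'
      · exact h
      · exact hg m h'
  have hftm : (f ^ t).Monic := hfm.pow t
  have hftn : (f ^ t).natDegree = n * t := by rw [hfm.natDegree_pow, hfn, mul_comm]
  refine card_fib (lcoeff R ρ).toAddMonoidHom (Dlt q I (ρ + 1)) (Dlt q I ρ)
    (Ideal.span {γ ^ (if ρ < n * t then a + 1 else a)} : Ideal R).toAddSubgroup ?_ ?_ ?_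
  · intro g hg
    rw [mem_Dlt] at hg ⊢
    refine ⟨lt_trans hg.1 ?_, hg.2⟩
    exact_mod_cast Nat.lt_succ_self ρ
  · intro g hg
    rw [mem_Dlt] at hg ⊢
    change g.coeff ρ = 0 ↔ _
    rw [hdeg g hg.1]
    exact ⟨fun h => ⟨h, hg.2⟩, fun h => h.1⟩
  · intro y
    rw [Submodule.mem_toAddSubgroup, Ideal.mem_span_singleton]
    constructor
    · rintro ⟨r, rfl⟩
      split_ifs with hlt
      · refine ⟨C (γ ^ (a + 1) * r) * X ^ ρ, ?_, ?_⟩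
        · rw [mem_Dlt]
          constructor
          · refine lt_of_le_of_lt (degree_C_mul_X_pow_le _ _) ?_
            exact_mod_cast Nat.lt_succ_self ρ
          · rw [C_mul, C_pow, mul_assoc, map_mul]
            exact Ideal.mul_mem_right _ _ hg2
        · change (C (γ ^ (a + 1) * r) * X ^ ρ).coeff ρ = _
          rw [coeff_C_mul, coeff_X_pow, if_pos rfl, mul_one]
      · have hM : (f ^ t * X ^ (ρ - n * t)).Monic := hftm.mul (monic_X_pow _)
        have hMn : (f ^ t * X ^ (ρ - n * t)).natDegree = ρ := by
          rw [hftm.natDegree_mul (monic_X_pow _), hftn, natDegree_X_pow]; omega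
        refine ⟨C (γ ^ a * r) * (f ^ t * X ^ (ρ - n * t)), ?_, ?_⟩
        · rw [mem_Dlt]
          constructor
          · rw [← smul_eq_C_mul]
            refine lt_of_le_of_lt (degree_smul_le _ _) ?_
            rw [degree_eq_natDegree hM.ne_zero, hMn]
            exact_mod_cast Nat.lt_succ_self ρ
          · have : C (γ ^ a * r) * (f ^ t * X ^ (ρ - n * t)) =
              (C γ ^ a * f ^ t) * (C r * X ^ (ρ - n * t)) := by
              rw [C_mul, C_pow]; ring
            rw [this, map_mul]
            exact Ideal.mul_mem_right _ _ hg1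
        · change (C (γ ^ a * r) * (f ^ t * X ^ (ρ - n * t))).coeff ρ = _
          have h1 : (f ^ t * X ^ (ρ - n * t)).coeff ρ = 1 := by
            have := hM.coeff_natDegree
            rwa [hMn] at this
          rw [coeff_C_mul, h1, mul_one]
    · rintro ⟨g, hg, rfl⟩
      rw [mem_Dlt] at hg
      change _ ∣ g.coeff ρ
      obtain ⟨h1, h2, hgf⟩ := hform g
        (by rw [hN]; exact lt_of_lt_of_le hg.1 (by exact_mod_cast hρ)) hg.2
      split_ifs with hlt
      · have e1 : g %ₘ (f ^ t) = g := by
          rw [modByMonic_eq_self_iff hftm, degree_eq_natDegree hftm.ne_zero, hftn]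
          exact lt_of_lt_of_le hg.1 (by exact_mod_cast hlt)
        have e2 : g = f ^ t * (C γ ^ a * h1) + γ ^ (a + 1) • h2 := by
          rw [hgf, smul_eq_C_mul, C_pow]; ring
        have e3 : (f ^ t * (C γ ^ a * h1)) %ₘ (f ^ t) = 0 :=
          (modByMonic_eq_zero_iff_dvd hftm).2 (dvd_mul_right _ _)
        rw [← e1, e2, add_modByMonic, e3, zero_add, smul_modByMonic, coeff_smul, smul_eq_mul]
        exact dvd_mul_right _ _
      · rw [hgf, ← C_pow, coeff_C_mul]
        exact dvd_mul_right _ _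

lemma Dlt_card {R : Type} [CommRing R] [Finite R] [Nontrivial R] (q f v : R[X]) (γ : R)
    (P a t n N e Q : ℕ)
    (hQ : ∀ j, Nat.card (Ideal.span {γ ^ j} : Ideal R) = Q ^ (e - j))
    (hq : q.Monic) (hN : q.degree = N) (hfm : f.Monic) (hfn : f.natDegree = n)
    (hf : f ^ P = q + C γ * v) (ht : t ≤ P)
    (hv : IsUnit (Ideal.Quotient.mk (Ideal.span {q}) v)) (ρ : ℕ) (hρ : ρ ≤ N) :
    Nat.card (Dlt q (Ideal.span {Ideal.Quotient.mk (Ideal.span {q}) (f ^ (a * P + t))}) ρ) =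
      Q ^ ((e - (a + 1)) * min ρ (n * t) + (e - a) * (ρ - n * t)) := by
  induction ρ with
  | zero =>
    have : Dlt q (Ideal.span {Ideal.Quotient.mk (Ideal.span {q}) (f ^ (a * P + t))}) 0 = ⊥ := by
      rw [eq_bot_iff]
      intro g hg
      rw [mem_Dlt] at hg
      have h := hg.1
      rw [degree_lt_iff_coeff_zero] at h
      rw [AddSubgroup.mem_bot]
      ext i
      exact h i (Nat.zero_le i)
    rw [this]
    simp
  | succ ρ ih =>
    rw [Dlt_step q f v γ P a t n N hq hN hfm hfn hf ht hv ρ hρ, ih (by omega), hQ, ← pow_add]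
    congr 1
    split_ifs with h
    · rw [min_eq_left (by omega : ρ ≤ n * t), min_eq_left (by omega : ρ + 1 ≤ n * t),
        Nat.sub_eq_zero_of_le (by omega : ρ ≤ n * t),
        Nat.sub_eq_zero_of_le (by omega : ρ + 1 ≤ n * t)]
      ring
    · rw [min_eq_right (by omega), min_eq_right (by omega), Nat.succ_sub (by omega)]
      rw [Nat.mul_succ]; ring

lemma rt_main {R : Type} [CommRing R] [Finite R] [Nontrivial R] (q f v : R[X]) (γ : R)
    (P a t n N e Q : ℕ)
    (hQ : ∀ j, Nat.card (Ideal.span {γ ^ j} : Ideal R) = Q ^ (e - j))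
    (hq : q.Monic) (hN : q.degree = N) (hfm : f.Monic) (hfn : f.natDegree = n)
    (hf : f ^ P = q + C γ * v) (ht : t ≤ P)
    (hv : IsUnit (Ideal.Quotient.mk (Ideal.span {q}) v)) (ρ : ℕ) (hρ : ρ < N) :
    rtCount q (Ideal.span {Ideal.Quotient.mk (Ideal.span {q}) (f ^ (a * P + t))}) (ρ + 1) =
      (Q ^ (e - (if ρ < n * t then a + 1 else a)) - 1) *
      Q ^ ((e - (a + 1)) * min ρ (n * t) + (e - a) * (ρ - n * t)) := by
  rw [rtCount_succ q hq _ N hN ρ hρ, Dlt_step q f v γ P a t n N hq hN hfm hfn hf ht hv ρ hρ,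
    Dlt_card q f v γ P a t n N e Q hQ hq hN hfm hfn hf ht hv ρ hρ.le, hQ]
  generalize Q ^ (e - (if ρ < n * t then a + 1 else a)) = A
  rw [Nat.sub_mul A, one_mul, mul_comm]

lemma unit_v {R : Type} [CommRing R] (q f k : R[X]) (γ w : R) (P e : ℕ) (hγe : γ ^ e = 0)
    (hw : IsUnit w) (hf : f ^ P = q + C γ * (-(f * k) + C w)) :
    IsUnit (Ideal.Quotient.mk (Ideal.span {q}) (-(f * k) + C w)) := by
  have hq0 := Ideal.Quotient.eq_zero_iff_mem.2 (Ideal.mem_span_singleton_self q)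
  have hF := congrArg (Ideal.Quotient.mk (Ideal.span {q})) hf
  rw [map_add, hq0, zero_add, map_pow, map_mul] at hF
  rw [map_add]
  apply nil_add_unit
  · rw [map_neg, map_mul]
    refine IsNilpotent.neg ⟨P * e, ?_⟩
    rw [mul_pow, pow_mul, hF, mul_pow (Ideal.Quotient.mk _ (C γ)), ← map_pow, ← C_pow, hγe, C_0,
      map_zero, zero_mul, zero_mul]
  · exact (hw.map C).map _

/-- RT weight distributions of the `λ`-constacyclic codes
`⟨(x^n − λ₀)^ν⟩` of length `np^s` over a finite chain ring of nilpotency index `e`,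
`λ = λ₀^{p^s} + γw`. -/
theorem stmt19 {R : Type} [CommRing R] [Finite R]
    (e p m s n : ℕ) (he : 2 ≤ e) (hp : p.Prime) (hm : 0 < m) (hs : 0 < s) (hn : 0 < n)
    (hnp : Nat.gcd n p = 1)
    (γ : R) (hγ : γ ^ (e - 1) ≠ 0) (hγe : γ ^ e = 0)
    (hmax : ∀ a : R, a ∈ Ideal.span {γ} ↔ ¬ IsUnit a)
    (hres : Nat.card (R ⧸ Ideal.span {γ}) = p ^ m)
    (l₀ w : R) (hl₀ : IsUnit l₀) (hw : IsUnit w)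
    (hirr : Irreducible ((X ^ n - C l₀ : R[X]).map (Ideal.Quotient.mk (Ideal.span {γ}))))
    (ν : ℕ) (hν : ν ≤ e * p ^ s) :
    rtCount (X ^ (n * p ^ s) - C (l₀ ^ p ^ s + γ * w))
      (Ideal.span {Ideal.Quotient.mk
        (Ideal.span {(X ^ (n * p ^ s) - C (l₀ ^ p ^ s + γ * w) : R[X])})
        ((X ^ n - C l₀) ^ ν)}) 0 = 1 ∧
    (ν = e * p ^ s → ∀ ρ, 1 ≤ ρ → ρ ≤ n * p ^ s →
      rtCount (X ^ (n * p ^ s) - C (l₀ ^ p ^ s + γ * w))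
        (Ideal.span {Ideal.Quotient.mk
          (Ideal.span {(X ^ (n * p ^ s) - C (l₀ ^ p ^ s + γ * w) : R[X])})
          ((X ^ n - C l₀) ^ ν)}) ρ = 0) ∧
    ((e - 1) * p ^ s + 1 ≤ ν → ν ≤ e * p ^ s - 1 →
      (∀ ρ, 1 ≤ ρ → ρ ≤ n * ν - n * (e - 1) * p ^ s →
        rtCount (X ^ (n * p ^ s) - C (l₀ ^ p ^ s + γ * w))
          (Ideal.span {Ideal.Quotient.mk
            (Ideal.span {(X ^ (n * p ^ s) - C (l₀ ^ p ^ s + γ * w) : R[X])})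
            ((X ^ n - C l₀) ^ ν)}) ρ = 0) ∧
      (∀ ρ, n * ν - n * (e - 1) * p ^ s + 1 ≤ ρ → ρ ≤ n * p ^ s →
        rtCount (X ^ (n * p ^ s) - C (l₀ ^ p ^ s + γ * w))
          (Ideal.span {Ideal.Quotient.mk
            (Ideal.span {(X ^ (n * p ^ s) - C (l₀ ^ p ^ s + γ * w) : R[X])})
            ((X ^ n - C l₀) ^ ν)}) ρ =
          (p ^ m - 1) * p ^ (m * (ρ + n * (e - 1) * p ^ s - n * ν - 1)))) ∧
    (∀ y, y ≤ e - 1 → ν = y * p ^ s → ∀ ρ, 1 ≤ ρ → ρ ≤ n * p ^ s →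
      rtCount (X ^ (n * p ^ s) - C (l₀ ^ p ^ s + γ * w))
        (Ideal.span {Ideal.Quotient.mk
          (Ideal.span {(X ^ (n * p ^ s) - C (l₀ ^ p ^ s + γ * w) : R[X])})
          ((X ^ n - C l₀) ^ ν)}) ρ =
        (p ^ (m * (e - y)) - 1) * p ^ (m * (e - y) * (ρ - 1))) ∧
    (∀ b, 1 ≤ b → b ≤ e - 1 → (b - 1) * p ^ s + 1 ≤ ν → ν ≤ b * p ^ s - 1 →
      (∀ ρ, 1 ≤ ρ → ρ ≤ n * ν - n * (b - 1) * p ^ s →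
        rtCount (X ^ (n * p ^ s) - C (l₀ ^ p ^ s + γ * w))
          (Ideal.span {Ideal.Quotient.mk
            (Ideal.span {(X ^ (n * p ^ s) - C (l₀ ^ p ^ s + γ * w) : R[X])})
            ((X ^ n - C l₀) ^ ν)}) ρ =
          (p ^ (m * (e - b)) - 1) * p ^ (m * (e - b) * (ρ - 1))) ∧
      (∀ ρ, n * ν - n * (b - 1) * p ^ s + 1 ≤ ρ → ρ ≤ n * p ^ s →
        rtCount (X ^ (n * p ^ s) - C (l₀ ^ p ^ s + γ * w))
          (Ideal.span {Ideal.Quotient.mk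
            (Ideal.span {(X ^ (n * p ^ s) - C (l₀ ^ p ^ s + γ * w) : R[X])})
            ((X ^ n - C l₀) ^ ν)}) ρ =
          (p ^ (m * (e - b + 1)) - 1) *
            p ^ (m * ((e - b + 1) * ρ + n * (b - 1) * p ^ s - n * ν - 1 - (e - b))))) := by

  have hγu : ¬ IsUnit γ := (hmax γ).1 (Ideal.mem_span_singleton_self γ)
  have hnt : Nontrivial R := ⟨⟨γ ^ (e - 1), 0, hγ⟩⟩
  have hP : 0 < p ^ s := pow_pos hp.pos s
  have hN0 : 0 < n * p ^ s := Nat.mul_pos hn hP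
  have hpγ : ∃ c : R, (p : R) = γ * c := by
    have h1 : (p : R) ∈ Ideal.span {γ} := by
      rw [hmax]
      intro hu
      have h2 : ((p ^ m : ℕ) : R ⧸ Ideal.span {γ}) = 0 := by
        rw [← hres]
        have hfin : Finite (R ⧸ Ideal.span {γ}) :=
          Finite.of_surjective _ (Ideal.Quotient.mk_surjective (I := Ideal.span {γ}))
        have := Fintype.ofFinite (R ⧸ Ideal.span {γ})
        rw [Nat.card_eq_fintype_card]
        exact Nat.cast_card_eq_zero _
      have h3 : Ideal.Quotient.mk (Ideal.span {γ}) ((p : R) ^ m) = 0 := by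
        rw [← h2]; simp
      rw [Ideal.Quotient.eq_zero_iff_mem, hmax] at h3
      exact h3 (hu.pow m)
    obtain ⟨c, hc⟩ := Ideal.mem_span_singleton.1 h1
    exact ⟨c, hc⟩
  have hQ := card_gamma e (p ^ m) γ hγ hγe hmax hres
  have hqm : (X ^ (n * p ^ s) - C (l₀ ^ p ^ s + γ * w) : R[X]).Monic :=
    monic_X_pow_sub_C _ hN0.ne'
  have hqd : (X ^ (n * p ^ s) - C (l₀ ^ p ^ s + γ * w) : R[X]).degree = (n * p ^ s : ℕ) :=
    degree_X_pow_sub_C hN0 _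
  have hfm : (X ^ n - C l₀ : R[X]).Monic := monic_X_pow_sub_C _ hn.ne'
  have hfn : (X ^ n - C l₀ : R[X]).natDegree = n := natDegree_X_pow_sub_C
  obtain ⟨v, hf, hv⟩ : ∃ v : R[X],
      (X ^ n - C l₀ : R[X]) ^ p ^ s =
        (X ^ (n * p ^ s) - C (l₀ ^ p ^ s + γ * w)) + C γ * v ∧
      IsUnit (Ideal.Quotient.mk
        (Ideal.span {(X ^ (n * p ^ s) - C (l₀ ^ p ^ s + γ * w) : R[X])}) v) := by
    obtain ⟨c, hc⟩ := hpγ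
    obtain ⟨r, hr⟩ := exists_add_pow_prime_pow_eq hp (X ^ n - C l₀ : R[X]) (C l₀) s
    have hpc : (p : R[X]) = C γ * C c := by
      rw [← C_mul, ← hc]; simp
    have hf : (X ^ n - C l₀ : R[X]) ^ p ^ s =
        (X ^ (n * p ^ s) - C (l₀ ^ p ^ s + γ * w)) +
          C γ * (-((X ^ n - C l₀) * (C c * C l₀ * r)) + C w) := by
      rw [sub_add_cancel, hpc] at hr
      rw [pow_mul, C_add, C_mul, C_pow]
      linear_combination -hr
    exact ⟨_, hf, unit_v _ _ _ γ w (p ^ s) e hγe hw hf⟩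
  have key : ∀ a t, t ≤ p ^ s → ∀ ρ, ρ < n * p ^ s → _ := fun a t ht ρ hρ =>
    rt_main _ _ v γ (p ^ s) a t n (n * p ^ s) e (p ^ m) hQ hqm hqd hfm hfn hf ht hv ρ hρ
  clear hf hv hQ hqm hqd hfm hfn hpγ
  refine ⟨rtCount_zero _ _, ?_, ?_, ?_, ?_⟩
  · rintro rfl ρ h1 h2
    obtain ⟨k, rfl⟩ : ∃ k, ρ = k + 1 := ⟨ρ - 1, by omega⟩
    have h := key e 0 (Nat.zero_le _) k (by omega)
    rw [add_zero] at h
    rw [h]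
    simp
  · intro hlo hhi
    obtain ⟨t, rfl⟩ : ∃ t, ν = (e - 1) * p ^ s + t := ⟨ν - (e - 1) * p ^ s, by omega⟩
    have hee : e * p ^ s = (e - 1) * p ^ s + p ^ s := by
      rw [← Nat.succ_mul]; congr 1; omega
    have hnt' : n * ((e - 1) * p ^ s + t) = n * (e - 1) * p ^ s + n * t := by ring
    have he1 : e - (e - 1 + 1) = 0 := by omega
    have he2 : e - (e - 1) = 1 := by omega
    constructor
    · intro ρ h1 h2
      rw [hnt', Nat.add_sub_cancel_left] at h2
      have h3 : n * t ≤ n * p ^ s := Nat.mul_le_mul_left _ (by omega)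
      obtain ⟨k, rfl⟩ : ∃ k, ρ = k + 1 := ⟨ρ - 1, by omega⟩
      rw [key (e - 1) t (by omega) k (by omega), if_pos (by omega), he1]
      simp
    · intro ρ h1 h2
      rw [hnt'] at h1 ⊢
      rw [Nat.add_sub_cancel_left] at h1
      obtain ⟨k, rfl⟩ : ∃ k, ρ = k + 1 := ⟨ρ - 1, by omega⟩
      rw [key (e - 1) t (by omega) k (by omega), if_neg (by omega), he1, he2, pow_one, zero_mul,
        zero_add, one_mul, ← pow_mul]
      congr 3
      omega
  · rintro y hy rfl ρ h1 h2
    obtain ⟨k, rfl⟩ : ∃ k, ρ = k + 1 := ⟨ρ - 1, by omega⟩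
    have h := key y 0 (Nat.zero_le _) k (by omega)
    rw [add_zero] at h
    rw [h]
    simp [← pow_mul, mul_assoc]
  · intro b hb1 hb2 hlo hhi
    obtain ⟨a, rfl⟩ : ∃ a, b = a + 1 := ⟨b - 1, by omega⟩
    rw [Nat.add_sub_cancel] at *
    obtain ⟨t, rfl⟩ : ∃ t, ν = a * p ^ s + t := ⟨ν - a * p ^ s, by omega⟩
    rw [Nat.succ_mul] at hhi
    have hnt' : n * (a * p ^ s + t) = n * a * p ^ s + n * t := by ring
    obtain ⟨d, rfl⟩ : ∃ d, e = a + 1 + d := ⟨e - (a + 1), by omega⟩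
    have he1 : a + 1 + d - (a + 1) = d := by omega
    have he2 : a + 1 + d - a = d + 1 := by omega
    constructor
    · intro ρ h1 h2
      rw [hnt', Nat.add_sub_cancel_left] at h2
      have h3 : n * t ≤ n * p ^ s := Nat.mul_le_mul_left _ (by omega)
      obtain ⟨k, rfl⟩ : ∃ k, ρ = k + 1 := ⟨ρ - 1, by omega⟩
      rw [key a t (by omega) k (by omega), if_pos (by omega), he1, min_eq_left (by omega),
        Nat.sub_eq_zero_of_le (by omega : k ≤ n * t), ← pow_mul, ← pow_mul]
      simp [mul_assoc]
    · intro ρ h1 h2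
      rw [hnt'] at h1 ⊢
      rw [Nat.add_sub_cancel_left] at h1
      obtain ⟨k, rfl⟩ : ∃ k, ρ = n * t + k + 1 := ⟨ρ - 1 - n * t, by omega⟩
      rw [key a t (by omega) _ (by omega), if_neg (by omega), he1, he2, min_eq_right (by omega),
        ← pow_mul, ← pow_mul]
      congr 3
      rw [show n * t + k - n * t = k by omega]
      have : (d + 1) * (n * t + k + 1) = d * (n * t) + (d + 1) * k + n * t + 1 + d := by ring
      rw [this]
      omega
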